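/- Let n ≥ 2 be an integer. An element of Φ(P_{G_n}) is completely fundamental if and only if it is one of (L_1, 1), (L_2, 1), …, (L_n, 1), (0⃗, 1), or (L_*, n−1). -/

import Mathlib

open Finset

/-- Vertices of the graph `G n`: `Sum.inl i` is `aᵢ`, `Sum.inr (Sum.inl i)` is `bᵢ`,
`Sum.inr (Sum.inr false)` is `x`, and `Sum.inr (Sum.inr true)` is `y`. -/
abbrev Vn (n : ℕ) := Fin n ⊕ Fin n ⊕ Bool

def va {n : ℕ} (i : Fin n) : Vn n := Sum.inl i
def vb {n : ℕ} (i : Fin n) : Vn n := Sum.inr (Sum.inl i)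
def vx {n : ℕ} : Vn n := Sum.inr (Sum.inr false)
def vy {n : ℕ} : Vn n := Sum.inr (Sum.inr true)

/-- The edge set of the graph `Gₙ`: edges `aᵢbᵢ`, `x aᵢ` and `y bᵢ` for `1 ≤ i ≤ n`. -/
def Gedges (n : ℕ) : Finset (Sym2 (Vn n)) :=
  (Finset.univ.image fun i : Fin n => s(va i, vb i)) ∪
  (Finset.univ.image fun i : Fin n => s(vx, va i)) ∪
  (Finset.univ.image fun i : Fin n => s(vy, vb i))

/-- Sum of the labels of the edges incident to `v`. -/
def vsum {V : Type} [DecidableEq V] (E : Finset (Sym2 V)) (L : E → ℕ) (v : V) : ℕ :=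
  ∑ e ∈ E.attach, if v ∈ e.1 then L e else 0

/-- A labeling is magic if the label sum is the same at every vertex. -/
def IsMagic {V : Type} [DecidableEq V] (E : Finset (Sym2 V)) (L : E → ℕ) : Prop :=
  ∀ v w : V, vsum E L v = vsum E L w

/-- The perfect matching labeling `Lᵢ`: label `1` on the edges `x aᵢ`, `y bᵢ`, and
`aⱼbⱼ` for `j ≠ i`, and `0` on all other edges. -/
def Lmatch (n : ℕ) (i : Fin n) : ↥(Gedges n) → ℕ :=
  fun e => if (∃ j, j ≠ i ∧ e.1 = s(va j, vb j)) ∨ e.1 = s(vx, va i) ∨ e.1 = s(vy, vb i)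
    then 1 else 0

/-- The labeling `L⁎` assigning `n - 1` to each edge `aᵢbᵢ` and `1` to each edge
`x aᵢ` and `y bᵢ` (the latter being exactly the edges containing `x` or `y`). -/
def Lstar (n : ℕ) : ↥(Gedges n) → ℕ :=
  fun e => if (vx : Vn n) ∈ e.1 ∨ (vy : Vn n) ∈ e.1 then 1 else n - 1

/-- The semigroup `Φ(P_G)`: pairs `(L, k)` where `L` is a magic labeling with all
labels at most `k`, under componentwise addition. -/
def PhiP {V : Type} [DecidableEq V] (E : Finset (Sym2 V)) : Set ((E → ℕ) × ℕ) :=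
  {p | IsMagic E p.1 ∧ ∀ e, p.1 e ≤ p.2}

/-- A nonzero element `a` of an additive semigroup `Φ` is completely fundamental if
whenever `b + c = m • a` with `b, c ∈ Φ` and `m` a positive integer, both `b` and `c`
are nonnegative integer multiples of `a`. -/
def CompletelyFundamental {α : Type} [AddCommMonoid α] (Φ : Set α) (a : α) : Prop :=
  a ∈ Φ ∧ a ≠ 0 ∧ ∀ b ∈ Φ, ∀ c ∈ Φ, ∀ m : ℕ, 0 < m → b + c = m • a →
    (∃ β : ℕ, b = β • a) ∧ (∃ γ : ℕ, c = γ • a)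

section General

variable {V : Type} [DecidableEq V] {E : Finset (Sym2 V)}

theorem vsum_add (L M : E → ℕ) (v : V) : vsum E (L + M) v = vsum E L v + vsum E M v := by
  simp only [vsum, ← Finset.sum_add_distrib]
  exact Finset.sum_congr rfl fun e _ => by split_ifs <;> simp

theorem IsMagic.of_add_left {L M : E → ℕ} (hL : IsMagic E L) (h : IsMagic E (L + M)) :
    IsMagic E M := by
  intro v w
  have h₁ := h v w
  have h₂ := hL v w
  rw [vsum_add, vsum_add] at h₁
  omega

/-- If `a` is completely fundamental and `a - g` lies in `Φ(P_G)`, then `g` is a multiple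
of `a`. -/
theorem CompletelyFundamental.exists_eq_smul {a g : (E → ℕ) × ℕ}
    (ha : CompletelyFundamental (PhiP E) a) (hg : g ∈ PhiP E) (hle : g ≤ a)
    (hsub : ∀ e, a.1 e + g.2 ≤ a.2 + g.1 e) : ∃ β : ℕ, g = β • a := by
  obtain ⟨hmem, -, hdec⟩ := ha
  have hadd : g + (a - g) = a := by
    ext e
    · exact Nat.add_sub_cancel' (hle.1 e)
    · exact Nat.add_sub_cancel' hle.2
  refine (hdec g hg (a - g) ⟨?_, fun e => ?_⟩ 1 one_pos (by rw [hadd, one_smul])).1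
  · exact IsMagic.of_add_left hg.1 (by rw [← Prod.fst_add, hadd]; exact hmem.1)
  · have h₁ := hsub e
    have h₂ := hle.1 e
    have h₃ := hle.2
    simp only [Prod.fst_sub, Prod.snd_sub, Pi.sub_apply]
    omega

end General

section Gn

variable {n : ℕ}

/-- The edge `aᵢbᵢ`. -/
def edgeAB (i : Fin n) : ↥(Gedges n) := ⟨s(va i, vb i), by simp [Gedges, va, vb, vx, vy]⟩

/-- The edge `x aᵢ`. -/
def edgeXA (i : Fin n) : ↥(Gedges n) := ⟨s(vx, va i), by simp [Gedges, va, vb, vx, vy]⟩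

/-- The edge `y bᵢ`. -/
def edgeYB (i : Fin n) : ↥(Gedges n) := ⟨s(vy, vb i), by simp [Gedges, va, vb, vx, vy]⟩

theorem forall_edge {p : ↥(Gedges n) → Prop} :
    (∀ e, p e) ↔ ∀ i, p (edgeAB i) ∧ p (edgeXA i) ∧ p (edgeYB i) := by
  refine ⟨fun h i => ⟨h _, h _, h _⟩, ?_⟩
  rintro h ⟨e, he⟩
  have he' := he
  simp only [Gedges, mem_union, mem_image, mem_univ, true_and] at he'
  rcases he' with (⟨i, rfl⟩ | ⟨i, rfl⟩) | ⟨i, rfl⟩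
  exacts [(h i).1, (h i).2.1, (h i).2.2]

theorem edge_bijective :
    Function.Bijective (Sum.elim edgeAB (Sum.elim edgeXA edgeYB) :
      Fin n ⊕ Fin n ⊕ Fin n → ↥(Gedges n)) := by
  constructor
  · rintro (i | i | i) (j | j | j) <;>
      simp [edgeAB, edgeXA, edgeYB, va, vb, vx, vy]
  · exact forall_edge.2 fun i =>
      ⟨⟨.inl i, rfl⟩, ⟨.inr (.inl i), rfl⟩, ⟨.inr (.inr i), rfl⟩⟩

theorem vsum_Gedges (L : ↥(Gedges n) → ℕ) (v : Vn n) :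
    vsum (Gedges n) L v =
      (∑ i, if v ∈ (edgeAB i).1 then L (edgeAB i) else 0) +
      ((∑ i, if v ∈ (edgeXA i).1 then L (edgeXA i) else 0) +
        ∑ i, if v ∈ (edgeYB i).1 then L (edgeYB i) else 0) := by
  rw [vsum, ← Finset.univ_eq_attach, ← edge_bijective.sum_comp]
  simp only [Fintype.sum_sum_type, Sum.elim_inl, Sum.elim_inr]
  rfl

theorem vsum_va (L : ↥(Gedges n) → ℕ) (i : Fin n) :
    vsum (Gedges n) L (va i) = L (edgeAB i) + L (edgeXA i) := by
  simp [vsum_Gedges, edgeAB, edgeXA, edgeYB, va, vb, vx, vy]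

theorem vsum_vb (L : ↥(Gedges n) → ℕ) (i : Fin n) :
    vsum (Gedges n) L (vb i) = L (edgeAB i) + L (edgeYB i) := by
  simp [vsum_Gedges, edgeAB, edgeXA, edgeYB, va, vb, vx, vy]

theorem vsum_vx (L : ↥(Gedges n) → ℕ) :
    vsum (Gedges n) L vx = ∑ i, L (edgeXA i) := by
  simp [vsum_Gedges, edgeAB, edgeXA, edgeYB, va, vb, vx, vy]

theorem vsum_vy (L : ↥(Gedges n) → ℕ) :
    vsum (Gedges n) L vy = ∑ i, L (edgeYB i) := by
  simp [vsum_Gedges, edgeAB, edgeXA, edgeYB, va, vb, vx, vy]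

theorem isMagic_Gedges_iff {L : ↥(Gedges n) → ℕ} :
    IsMagic (Gedges n) L ↔ ∀ i, L (edgeYB i) = L (edgeXA i) ∧
      L (edgeAB i) + L (edgeXA i) = ∑ j, L (edgeXA j) := by
  constructor
  · intro h i
    have h₁ := h (va i) (vb i)
    have h₂ := h (va i) vx
    rw [vsum_va, vsum_vb] at h₁
    rw [vsum_va, vsum_vx] at h₂
    omega
  · intro h
    have key : ∀ v, vsum (Gedges n) L v = ∑ j, L (edgeXA j) := by
      rintro (i | i | _ | _)
      · exact (vsum_va L i).trans (h i).2
      · exact (vsum_vb L i).trans ((h i).1 ▸ (h i).2)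
      · exact vsum_vx L
      · exact (vsum_vy L).trans (Finset.sum_congr rfl fun i _ => (h i).1)
    exact fun v w => (key v).trans (key w).symm

@[simp] theorem Lmatch_edgeAB (i j : Fin n) :
    Lmatch n i (edgeAB j) = if j = i then 0 else 1 := by
  by_cases h : j = i <;> simp [Lmatch, edgeAB, va, vb, vx, vy, h]

@[simp] theorem Lmatch_edgeXA (i j : Fin n) :
    Lmatch n i (edgeXA j) = if j = i then 1 else 0 := by
  simp [Lmatch, edgeXA, va, vb, vx, vy]

@[simp] theorem Lmatch_edgeYB (i j : Fin n) :
    Lmatch n i (edgeYB j) = if j = i then 1 else 0 := by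
  simp [Lmatch, edgeYB, va, vb, vx, vy]

@[simp] theorem Lstar_edgeAB (j : Fin n) : Lstar n (edgeAB j) = n - 1 := by
  simp [Lstar, edgeAB, va, vb, vx, vy]

@[simp] theorem Lstar_edgeXA (j : Fin n) : Lstar n (edgeXA j) = 1 := by
  simp [Lstar, edgeXA, vx]

@[simp] theorem Lstar_edgeYB (j : Fin n) : Lstar n (edgeYB j) = 1 := by
  simp [Lstar, edgeYB, vy]

theorem Lmatch_mem (i : Fin n) : (Lmatch n i, 1) ∈ PhiP (Gedges n) := by
  refine ⟨isMagic_Gedges_iff.2 fun j => ?_, forall_edge.2 fun j => ?_⟩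
  · by_cases h : j = i <;> simp [h]
  · by_cases h : j = i <;> simp [h]

theorem zero_one_mem : ((0, 1) : (↥(Gedges n) → ℕ) × ℕ) ∈ PhiP (Gedges n) :=
  ⟨isMagic_Gedges_iff.2 fun j => by simp, fun e => by simp⟩

theorem Lstar_mem (hn : 2 ≤ n) : (Lstar n, n - 1) ∈ PhiP (Gedges n) := by
  refine ⟨isMagic_Gedges_iff.2 fun j => ?_, forall_edge.2 fun j => ?_⟩
  · simp only [Lstar_edgeAB, Lstar_edgeXA, Lstar_edgeYB, sum_const, card_univ,
      Fintype.card_fin, smul_eq_mul, true_and]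
    omega
  · simp only [Lstar_edgeAB, Lstar_edgeXA, Lstar_edgeYB]
    omega

/-- It suffices to check one half of the definition, by symmetry of the summands. -/
theorem completelyFundamental_of_left {α : Type} [AddCommMonoid α] {Φ : Set α} {a : α}
    (hmem : a ∈ Φ) (h0 : a ≠ 0)
    (h : ∀ b ∈ Φ, ∀ c ∈ Φ, ∀ m : ℕ, b + c = m • a → ∃ β : ℕ, b = β • a) :
    CompletelyFundamental Φ a :=
  ⟨hmem, h0, fun b hb c hc m _ hbc =>
    ⟨h b hb c hc m hbc, h c hc b hb m ((add_comm c b).trans hbc)⟩⟩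

theorem completelyFundamental_zero_one :
    CompletelyFundamental (PhiP (Gedges n)) (0, 1) := by
  refine completelyFundamental_of_left zero_one_mem (by simp) ?_
  rintro ⟨L, k⟩ - ⟨M, l⟩ - m h
  refine ⟨k, ?_⟩
  have h₁ := congrArg Prod.fst h
  have hL : L = 0 := by
    funext e
    have := congrFun h₁ e
    simp only [Prod.fst_add, Prod.smul_fst, Pi.add_apply, smul_zero, Pi.zero_apply] at this
    simp only [Pi.zero_apply]
    omega
  simp [hL]

theorem completelyFundamental_Lmatch (hn : 2 ≤ n) (i : Fin n) :
    CompletelyFundamental (PhiP (Gedges n)) (Lmatch n i, 1) := by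
  refine completelyFundamental_of_left (Lmatch_mem i) (by simp) ?_
  rintro ⟨L, k⟩ ⟨hL, hLk⟩ ⟨M, l⟩ ⟨hM, hMl⟩ m h
  simp only [Prod.mk_add_mk, Prod.smul_mk, Prod.mk.injEq] at h hLk hMl
  obtain ⟨h, hkl⟩ := h
  have hLM : ∀ j, L (edgeXA j) + M (edgeXA j) = if j = i then m else 0 := fun j => by
    have := congrFun h (edgeXA j)
    simpa using this
  have hLi := hLM i
  rw [if_pos rfl] at hLi
  have hL0 : ∀ j, j ≠ i → L (edgeXA j) = 0 := fun j hj => by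
    have := hLM j
    rw [if_neg hj] at this
    omega
  have hM0 : ∀ j, j ≠ i → M (edgeXA j) = 0 := fun j hj => by
    have := hLM j
    rw [if_neg hj] at this
    omega
  have hsL : ∑ j, L (edgeXA j) = L (edgeXA i) := Fintype.sum_eq_single i hL0
  have hsM : ∑ j, M (edgeXA j) = M (edgeXA i) := Fintype.sum_eq_single i hM0
  rw [isMagic_Gedges_iff] at hL hM
  simp only [hsL] at hL
  simp only [hsM] at hM
  have : Nontrivial (Fin n) := Fin.nontrivial_iff_two_le.2 hn
  obtain ⟨j, hj⟩ := exists_ne i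
  have hk : L (edgeXA i) = k := by
    have := hL j
    have := hM j
    have := hLk (edgeAB j)
    have := hMl (edgeAB j)
    have := hL0 j hj
    have := hM0 j hj
    simp only [smul_eq_mul, mul_one] at hkl
    omega
  refine ⟨k, ?_⟩
  simp only [Prod.smul_mk, Prod.mk.injEq, smul_eq_mul, mul_one, and_true]
  refine funext (forall_edge.2 fun l => ?_)
  have := hL l
  by_cases hl : l = i
  · subst hl
    simp
    omega
  · have := hL0 l hl
    simp [hl]
    omega

theorem completelyFundamental_Lstar (hn : 2 ≤ n) :
    CompletelyFundamental (PhiP (Gedges n)) (Lstar n, n - 1) := by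
  refine completelyFundamental_of_left (Lstar_mem hn)
    (fun h => by have := congrArg Prod.snd h; simp at this; omega) ?_
  rintro ⟨L, k⟩ ⟨hL, hLk⟩ ⟨M, l⟩ ⟨hM, hMl⟩ m h
  simp only [Prod.mk_add_mk, Prod.smul_mk, Prod.mk.injEq, smul_eq_mul] at h hLk hMl
  obtain ⟨h, hkl⟩ := h
  have hAB : ∀ j, L (edgeAB j) + M (edgeAB j) = m * (n - 1) := fun j => by
    simpa using congrFun h (edgeAB j)
  have hk : ∀ j, L (edgeAB j) = k := fun j => by
    have := hAB j
    have := hLk (edgeAB j)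
    have := hMl (edgeAB j)
    omega
  replace hL := isMagic_Gedges_iff.1 hL
  simp only at hL
  let i : Fin n := ⟨0, by omega⟩
  have hconst : ∀ j, L (edgeXA j) = L (edgeXA i) := fun j => by
    have := hL j
    have := hL i
    have := hk j
    have := hk i
    omega
  have hsum : ∑ j, L (edgeXA j) = n * L (edgeXA i) := by
    simp [hconst]
  have hki : k = L (edgeXA i) * (n - 1) := by
    have h₁ := (hL i).2
    rw [hk, hsum] at h₁
    rw [Nat.mul_sub, mul_one, mul_comm]
    omega
  refine ⟨L (edgeXA i), ?_⟩
  simp only [Prod.smul_mk, Prod.mk.injEq, smul_eq_mul, hki, and_true]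
  refine funext (forall_edge.2 fun j => ?_)
  simp [hk, (hL j).1, hconst j, ← hki]

/-- A multiple `g` of `a` with some coordinate equal to `1` is equal to `a`. -/
theorem eq_of_eq_smul_of_apply_eq_one {ι : Type} {a g : (ι → ℕ) × ℕ} {β : ℕ}
    (h : g = β • a) (h1 : (∃ e, g.1 e = 1) ∨ g.2 = 1) : a = g := by
  subst h
  have hβ : β = 1 := by
    rcases h1 with ⟨e, he⟩ | he
    · exact Nat.eq_one_of_mul_eq_one_right (by simpa using he)
    · exact Nat.eq_one_of_mul_eq_one_right (by simpa using he)
  rw [hβ, one_smul]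

theorem CompletelyFundamental.eq_generator (hn : 2 ≤ n) {a : (↥(Gedges n) → ℕ) × ℕ}
    (ha : CompletelyFundamental (PhiP (Gedges n)) a) :
    (∃ i : Fin n, a = (Lmatch n i, 1)) ∨ a = (0, 1) ∨ a = (Lstar n, n - 1) := by
  have hk0 : a.2 ≠ 0 := fun h0 => ha.2.1 <| by
    refine Prod.ext (funext fun e => ?_) h0
    have := ha.1.2 e
    simp only [Prod.fst_zero, Pi.zero_apply]
    omega
  have : Nontrivial (Fin n) := Fin.nontrivial_iff_two_le.2 hn
  have hmagic := isMagic_Gedges_iff.1 ha.1.1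
  have hbd := ha.1.2
  have hpair : ∀ i j, i ≠ j → a.1 (edgeXA i) ≤ a.1 (edgeAB j) := fun i j hij => by
    have h₁ := Finset.add_le_sum (s := univ) (f := fun i => a.1 (edgeXA i))
      (fun _ _ => Nat.zero_le _) (mem_univ i) (mem_univ j) hij
    have h₂ := hmagic j
    omega
  by_cases hlt : ∀ i, a.1 (edgeAB i) < a.2
  · have hlt' : ∀ e, a.1 e < a.2 := forall_edge.2 fun i => by
      obtain ⟨j, hj⟩ := exists_ne i
      have := hpair i j hj.symm
      have := hlt j
      have := hlt i
      have := hmagic i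
      omega
    obtain ⟨β, hβ⟩ := ha.exists_eq_smul zero_one_mem
      ⟨fun e => Nat.zero_le _, Nat.one_le_iff_ne_zero.2 hk0⟩ hlt'
    exact .inr (.inl (eq_of_eq_smul_of_apply_eq_one hβ (.inr rfl)))
  push Not at hlt
  obtain ⟨i, hi⟩ := hlt
  replace hi : a.1 (edgeAB i) = a.2 := le_antisymm (hbd _) hi
  have hmin : ∀ j, a.1 (edgeXA i) ≤ a.1 (edgeXA j) := fun j => by
    have := hmagic i
    have := hmagic j
    have := hbd (edgeAB j)
    omega
  by_cases hj : ∃ j, a.1 (edgeXA i) < a.1 (edgeXA j)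
  · obtain ⟨j, hj⟩ := hj
    have hij : j ≠ i := by
      rintro rfl
      exact lt_irrefl _ hj
    have hle : ∀ e, Lmatch n j e ≤ a.1 e := forall_edge.2 fun l => by
      have := hmagic l
      by_cases hl : l = j
      · subst hl
        simp
        omega
      · have := hpair j l (Ne.symm hl)
        simp [hl]
        omega
    have hsub : ∀ e, a.1 e + 1 ≤ a.2 + Lmatch n j e := forall_edge.2 fun l => by
      have h₁ := hmagic l
      have h₂ := hmagic i
      by_cases hl : l = j
      · subst hl
        have := hbd (edgeXA l)
        simp
        omega
      · have hXA : a.1 (edgeXA l) < a.2 := by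
          by_cases hli : l = i
          · subst hli
            have := hpair j l hij
            omega
          · have h₃ := Finset.sum_le_sum_of_subset (f := fun i => a.1 (edgeXA i))
              (subset_univ {l, j, i})
            rw [sum_insert (by simp [hl, hli]), sum_pair hij] at h₃
            omega
        have := hbd (edgeAB l)
        simp [hl]
        omega
    obtain ⟨β, hβ⟩ := ha.exists_eq_smul (Lmatch_mem j)
      ⟨hle, Nat.one_le_iff_ne_zero.2 hk0⟩ hsub
    exact .inl ⟨j, eq_of_eq_smul_of_apply_eq_one hβ (.inr rfl)⟩
  · push Not at hj
    have hconst : ∀ j, a.1 (edgeXA j) = a.1 (edgeXA i) := fun j => le_antisymm (hj j) (hmin j)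
    obtain ⟨p, rfl⟩ : ∃ p, n = p + 1 := ⟨n - 1, by omega⟩
    have hAB : ∀ j, a.1 (edgeAB j) = p * a.1 (edgeXA i) := fun j => by
      have h₁ := (hmagic j).2
      simp only [hconst, sum_const, card_univ, Fintype.card_fin, smul_eq_mul, add_mul,
        one_mul] at h₁
      omega
    have hk : a.2 = p * a.1 (edgeXA i) := hi ▸ hAB i
    obtain ⟨t, ht⟩ : ∃ t, a.1 (edgeXA i) = t + 1 :=
      Nat.exists_eq_add_one_of_ne_zero fun h => hk0 (by rw [hk, h, mul_zero])
    have hpt : t ≤ p * t := Nat.le_mul_of_pos_left t (by omega)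
    have hle : ∀ e, Lstar (p + 1) e ≤ a.1 e := forall_edge.2 fun l => by
      simp [hAB, hconst, (hmagic l).1, ht, mul_add]
    have hsub : ∀ e, a.1 e + p ≤ a.2 + Lstar (p + 1) e := forall_edge.2 fun l => by
      simp [hAB, hconst, (hmagic l).1, ht, hk, mul_add]
      omega
    obtain ⟨β, hβ⟩ := ha.exists_eq_smul (Lstar_mem hn)
      ⟨hle, by simp [hk, ht, mul_add]⟩ hsub
    exact .inr (.inr (eq_of_eq_smul_of_apply_eq_one hβ (.inl ⟨edgeXA i, by simp⟩)))

end Gn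

/-- The completely fundamental elements of `Φ(P_{Gₙ})` are exactly
`(L₁,1), …, (Lₙ,1)`, `(0,1)`, and `(L⁎, n-1)`. -/
theorem completelyFundamental_PhiP_Gn (n : ℕ) (hn : 2 ≤ n)
    (a : (↥(Gedges n) → ℕ) × ℕ) :
    CompletelyFundamental (PhiP (Gedges n)) a ↔
      (∃ i : Fin n, a = (Lmatch n i, 1)) ∨ a = (0, 1) ∨ a = (Lstar n, n - 1) := by
  constructor
  · exact CompletelyFundamental.eq_generator hn
  · rintro (⟨i, rfl⟩ | rfl | rfl)
    · exact completelyFundamental_Lmatch hn i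
    · exact completelyFundamental_zero_one
    · exact completelyFundamental_Lstar hn
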